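/- Let F and C be finite index types and let L be a symmetric positive semidefinite real matrix indexed by F ⊕ C such that all off-diagonal entries of L are nonpositive, every row of L sums to zero (L·𝟙 = 0), and the block L_FF is invertible. Then the Schur complement SC(L, C) is symmetric positive semidefinite, all of its off-diagonal entries are nonpositive, and every row of SC(L, C) sums to zero. (In particular, the Schur complement of a weighted graph Laplacian onto a subset C of the vertices is again a weighted graph Laplacian on C.) -/

import Mathlib

open Matrix

/-- The Schur complement of a matrix `L` indexed by `F ⊕ C` onto `C`:
`SC(L, C) = L_CC - L_CF * L_FF⁻¹ * L_FC`. -/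
noncomputable def schurC {F C : Type*} [Fintype F] [DecidableEq F]
    (L : Matrix (F ⊕ C) (F ⊕ C) ℝ) : Matrix C C ℝ :=
  L.toBlocks₂₂ - L.toBlocks₂₁ * (L.toBlocks₁₁)⁻¹ * L.toBlocks₁₂

/-- A positive definite matrix with nonpositive off-diagonal entries is monotone. -/
theorem Matrix.PosDef.nonneg_of_mulVec_nonneg {n : Type*} [Fintype n]
    {A : Matrix n n ℝ} (hA : A.PosDef) (hoff : ∀ i j, i ≠ j → A i j ≤ 0)
    {x : n → ℝ} (hx : 0 ≤ A *ᵥ x) : 0 ≤ x := by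
  have hneg : x⁻ = 0 := by
    by_contra hne
    have hpos : 0 < x⁻ ⬝ᵥ (A *ᵥ x⁻) := by simpa using hA.dotProduct_mulVec_pos hne
    have hcross : x⁻ ⬝ᵥ (A *ᵥ x⁺) ≤ 0 := by
      simp only [dotProduct, mulVec, Finset.mul_sum]
      refine Finset.sum_nonpos fun i _ => Finset.sum_nonpos fun j _ => ?_
      by_cases hij : i = j
      · subst hij
        rcases le_total 0 (x i) with h | h
        · simp [negPart_eq_zero.2 h]
        · simp [posPart_eq_zero.2 h]
      · exact mul_nonpos_of_nonneg_of_nonpos (negPart_nonneg (x i))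
          (mul_nonpos_of_nonpos_of_nonneg (hoff i j hij) (posPart_nonneg (x j)))
    have htotal : 0 ≤ x⁻ ⬝ᵥ (A *ᵥ x) :=
      dotProduct_nonneg_of_nonneg (negPart_nonneg x) hx
    rw [← posPart_sub_negPart x, mulVec_sub, dotProduct_sub, posPart_sub_negPart] at htotal
    linarith
  exact negPart_eq_zero.1 hneg

/-- The inverse of a positive definite matrix with nonpositive off-diagonal entries is
entrywise nonnegative. -/
theorem Matrix.PosDef.inv_apply_nonneg {n : Type*} [Fintype n] [DecidableEq n]
    {A : Matrix n n ℝ} (hA : A.PosDef) (hoff : ∀ i j, i ≠ j → A i j ≤ 0) (i j : n) :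
    0 ≤ A⁻¹ i j := by
  have hx : 0 ≤ A *ᵥ (A⁻¹ *ᵥ Pi.single j 1) := by
    rw [mulVec_mulVec, mul_nonsing_inv _ ((isUnit_iff_isUnit_det A).1 hA.isUnit), one_mulVec]
    exact Pi.single_nonneg.2 zero_le_one
  simpa using hA.nonneg_of_mulVec_nonneg hoff hx i

/-- **The Schur complement of a weighted graph Laplacian is a weighted graph Laplacian.**
If `L` is symmetric positive semidefinite with nonpositive off-diagonal entries and zero row
sums, and its `(F, F)` block is invertible, then `SC(L, C)` is positive semidefinite, has
nonpositive off-diagonal entries, and has zero row sums. -/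
theorem schur_complement_of_laplacian_is_laplacian {F C : Type*}
    [Fintype F] [Fintype C] [DecidableEq F]
    (L : Matrix (F ⊕ C) (F ⊕ C) ℝ) (hL : L.PosSemidef)
    (hoff : ∀ i j, i ≠ j → L i j ≤ 0)
    (hrow : L *ᵥ (fun _ => (1 : ℝ)) = 0)
    (hFF : IsUnit (L.toBlocks₁₁).det) :
    (schurC L).PosSemidef ∧ (∀ i j : C, i ≠ j → schurC L i j ≤ 0) ∧
      schurC L *ᵥ (fun _ => (1 : ℝ)) = 0 := by
  have hherm : L.toBlocks₁₂ᴴ = L.toBlocks₂₁ := by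
    ext i j
    exact hL.isHermitian.apply (Sum.inr i) (Sum.inl j)
  have hA : L.toBlocks₁₁.PosDef :=
    (hL.submatrix Sum.inl).posDef_iff_isUnit.2 ((isUnit_iff_isUnit_det _).2 hFF)
  have hinv := hA.inv_apply_nonneg fun i j hij => hoff _ _ (Sum.inl_injective.ne hij)
  refine ⟨?_, fun i j hij => ?_, ?_⟩
  · let := invertibleOfIsUnitDet _ hFF
    rw [schurC, ← hherm, ← hA.fromBlocks₁₁, hherm, fromBlocks_toBlocks]
    exact hL
  · have hprod : 0 ≤ (L.toBlocks₂₁ * L.toBlocks₁₁⁻¹ * L.toBlocks₁₂) i j := by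
      refine Finset.sum_nonneg fun k _ => mul_nonneg_of_nonpos_of_nonpos
        (Finset.sum_nonpos fun l _ => ?_) (hoff _ _ Sum.inl_ne_inr)
      exact mul_nonpos_of_nonpos_of_nonneg (hoff _ _ Sum.inr_ne_inl) (hinv l k)
    exact sub_nonpos.2 ((hoff _ _ (Sum.inr_injective.ne hij)).trans hprod)
  · have hF : L.toBlocks₁₁ *ᵥ (fun _ => (1 : ℝ)) + L.toBlocks₁₂ *ᵥ (fun _ => (1 : ℝ)) = 0 := by
      ext i
      simpa [mulVec, dotProduct, toBlocks₁₁, toBlocks₁₂] using congrFun hrow (Sum.inl i)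
    have hC : L.toBlocks₂₁ *ᵥ (fun _ => (1 : ℝ)) + L.toBlocks₂₂ *ᵥ (fun _ => (1 : ℝ)) = 0 := by
      ext i
      simpa [mulVec, dotProduct, toBlocks₂₁, toBlocks₂₂] using congrFun hrow (Sum.inr i)
    rw [schurC, sub_mulVec, ← mulVec_mulVec, eq_neg_of_add_eq_zero_right hF, mulVec_neg,
      ← mulVec_mulVec, mulVec_mulVec _ L.toBlocks₁₁⁻¹, nonsing_inv_mul _ hFF, one_mulVec,
      sub_neg_eq_add, add_comm, hC]
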